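/- Let Γ be a distance-regular graph with classical parameters (D, b, α, β) such that b ≥ 2 and D ≥ 3, let r = [D], and let s be a positive integer such that Γ has the SPLS(s) property. Then more than ((c_2 − 2)/(c_2 − 1))·|V(Γ)| vertices of Γ are Delsarte vertices, and there exist two vertices x, y at distance 2 such that |[x, y]| ≥ b + 1. -/

import Mathlib

open SimpleGraph

namespace DRGPaper

variable {V : Type*}

/-- `Γ` is a distance-regular graph with diameter `D` and intersection arrays `cc`, `aa`, `bb`:
`Γ` is connected of diameter `D` and for any vertices `x, y` at distance `i ≤ D`, `y` has exactly
`cc i` neighbours at distance `i - 1` from `x`, `aa i` neighbours at distance `i` from `x`,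
and `bb i` neighbours at distance `i + 1` from `x`. -/
def IsDRG [Fintype V] (G : SimpleGraph V) (D : ℕ) (cc aa bb : ℕ → ℕ) : Prop :=
  G.Connected ∧
  (∀ x y : V, G.dist x y ≤ D) ∧
  (∃ x y : V, G.dist x y = D) ∧
  ∀ i : ℕ, i ≤ D → ∀ x y : V, G.dist x y = i →
    {z : V | G.Adj y z ∧ G.dist x z = i - 1}.ncard = cc i ∧
    {z : V | G.Adj y z ∧ G.dist x z = i}.ncard = aa i ∧
    {z : V | G.Adj y z ∧ G.dist x z = i + 1}.ncard = bb i

/-- `[j] = (b^j - 1)/(b - 1) = 1 + b + ⋯ + b^(j-1)` as a real number. -/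
def gauss (b j : ℕ) : ℝ := ∑ i ∈ Finset.range j, (b : ℝ) ^ i

/-- `Γ` has classical parameters `(D, b, α, β)`: it is distance-regular of diameter `D` with
`bb i = ([D] - [i])(β - α[i])` for `0 ≤ i ≤ D - 1` and `cc i = [i](1 + α[i-1])` for
`1 ≤ i ≤ D`. -/
def HasClassicalParams [Fintype V] (G : SimpleGraph V) (D b : ℕ) (α β : ℝ)
    (cc aa bb : ℕ → ℕ) : Prop :=
  IsDRG G D cc aa bb ∧
  (∀ i : ℕ, i ≤ D - 1 → (bb i : ℝ) = (gauss b D - gauss b i) * (β - α * gauss b i)) ∧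
  (∀ i : ℕ, 1 ≤ i → i ≤ D → (cc i : ℝ) = gauss b i * (1 + α * gauss b (i - 1)))

/-- `d(x, C) = min {d(x, y) : y ∈ C}`. -/
noncomputable def distToSet (G : SimpleGraph V) (x : V) (C : Set V) : ℕ :=
  sInf (G.dist x '' C)

/-- A maximal clique of `G`. -/
def IsMaxClique (G : SimpleGraph V) (s : Set V) : Prop :=
  G.IsClique s ∧ ∀ t : Set V, G.IsClique t → s ⊆ t → t = s

/-- The lines for the PLS(γ) property: maximal cliques with at least `γ` vertices. -/
def plsLines (G : SimpleGraph V) (γ : ℕ) : Set (Set V) :=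
  {ℓ : Set V | IsMaxClique G ℓ ∧ γ ≤ ℓ.ncard}

/-- `G` is the point graph of the partial linear space with line set `L`: any two adjacent
vertices lie on exactly one common line of `L`. -/
def IsPointGraphOf (G : SimpleGraph V) (L : Set (Set V)) : Prop :=
  ∀ x y : V, G.Adj x y → ∃! ℓ : Set V, ℓ ∈ L ∧ x ∈ ℓ ∧ y ∈ ℓ

/-- A vertex is a Delsarte vertex (w.r.t. the line set `L` and classical parameter `β`) if all
lines through it have exactly `β + 1` vertices. -/
def IsDelsarteVertex (L : Set (Set V)) (β : ℝ) (x : V) : Prop :=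
  ∀ ℓ ∈ L, x ∈ ℓ → (ℓ.ncard : ℝ) = β + 1

/-- The lines for the SPLS(c, s) property: maximal cliques with at least
`a1 + 2 - (c - 1)(s - 1)` vertices. -/
def splsLines (G : SimpleGraph V) (a1 c s : ℕ) : Set (Set V) :=
  {ℓ : Set V | IsMaxClique G ℓ ∧ (a1 : ℤ) + 2 - ((c : ℤ) - 1) * ((s : ℤ) - 1) ≤ (ℓ.ncard : ℤ)}

/-- The SPLS(c, s) property: `G` is the point graph of the partial linear space whose lines are
the maximal cliques with at least `a1 + 2 - (c-1)(s-1)` vertices, `a1 ≥ (2s-1)(c-1)`, each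
vertex lies on at most `s` lines, and every point not on a line `ℓ` is collinear with at most
`c` points of `ℓ`.  SPLS(s) is the case `c = c₂`. -/
def HasSPLS (G : SimpleGraph V) (a1 c s : ℕ) : Prop :=
  1 ≤ c ∧ 2 ≤ s ∧
  (2 * (s : ℤ) - 1) * ((c : ℤ) - 1) ≤ (a1 : ℤ) ∧
  IsPointGraphOf G (splsLines G a1 c s) ∧
  (∀ x : V, {ℓ ∈ splsLines G a1 c s | x ∈ ℓ}.ncard ≤ s) ∧
  (∀ ℓ ∈ splsLines G a1 c s, ∀ x : V, x ∉ ℓ → {y ∈ ℓ | G.Adj x y}.ncard ≤ c)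

/-- `[x, y]`: the set of lines `ℓ ∈ L` through `x` such that `d(y, u) ≤ 2` for all `u ∈ ℓ`. -/
def lineXY (G : SimpleGraph V) (L : Set (Set V)) (x y : V) : Set (Set V) :=
  {ℓ ∈ L | x ∈ ℓ ∧ ∀ u ∈ ℓ, G.dist y u ≤ 2}

/-- `𝓒` witnesses that `G` is geometric with cliques of order `q`: every member of `𝓒` is a
clique with exactly `q` vertices and every edge of `G` lies in a unique member of `𝓒`. -/
def IsGeomLineSet (G : SimpleGraph V) (q : ℝ) (𝓒 : Set (Set V)) : Prop :=
  (∀ C ∈ 𝓒, G.IsClique C ∧ (C.ncard : ℝ) = q) ∧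
  ∀ x y : V, G.Adj x y → ∃! C : Set V, C ∈ 𝓒 ∧ x ∈ C ∧ y ∈ C

/-- `G` is geometric: there is a set of Delsarte cliques (cliques of the maximum order `q`)
such that every edge lies in a unique member. -/
def IsGeometric (G : SimpleGraph V) (q : ℝ) : Prop :=
  ∃ 𝓒 : Set (Set V), IsGeomLineSet G q 𝓒

/-- An assembly: a maximal clique which is not a line. -/
def IsAssembly (G : SimpleGraph V) (𝓒 : Set (Set V)) (M : Set V) : Prop :=
  IsMaxClique G M ∧ M ∉ 𝓒

/-- The dual Pasch axiom: for every pair of adjacent vertices `x, y`, the common neighbours of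
`x` and `y` outside the (any) line of `𝓒` through `x` and `y` form a clique. -/
def DualPasch (G : SimpleGraph V) (𝓒 : Set (Set V)) : Prop :=
  ∀ x y : V, G.Adj x y → ∀ ℓ ∈ 𝓒, x ∈ ℓ → y ∈ ℓ →
    G.IsClique {z : V | G.Adj x z ∧ G.Adj y z ∧ z ∉ ℓ}

/-- The `m × n` grid, i.e. the Cartesian product `K_m □ K_n`. -/
def gridGraph (m n : ℕ) : SimpleGraph (Fin m × Fin n) :=
  (⊤ : SimpleGraph (Fin m)).boxProd (⊤ : SimpleGraph (Fin n))

/-- The `A`-clique extension of a graph `H`: replace every vertex of `H` by a clique of size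
`A`, vertices in distinct cliques being adjacent exactly when the underlying vertices of `H`
are adjacent. -/
def cliqueExt {W : Type*} (H : SimpleGraph W) (A : ℕ) : SimpleGraph (W × Fin A) :=
  SimpleGraph.fromRel (fun p q => H.Adj p.1 q.1 ∨ p.1 = q.1)

/-- `θ` is an eigenvalue of the adjacency matrix of `G`. -/
def IsAdjEigenvalue [Fintype V] (G : SimpleGraph V) [DecidableRel G.Adj] (θ : ℝ) : Prop :=
  ∃ v : V → ℝ, v ≠ 0 ∧ (G.adjMatrix ℝ).mulVec v = θ • v

section Aux

open scoped Classical in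
/-- The adjacency operator: the sum of `f` over the neighbours of `x`. -/
noncomputable def nbrSum [Fintype V] (G : SimpleGraph V) (f : V → ℝ) (x : V) : ℝ :=
  ∑ y, if G.Adj x y then f y else 0

open scoped Classical in
/-- The sum of `f` over the vertices of `ℓ`. -/
noncomputable def setSum [Fintype V] (ℓ : Set V) (f : V → ℝ) : ℝ :=
  ∑ y, if y ∈ ℓ then f y else 0

open scoped Classical in
/-- The sum of `f` over the vertices at distance `i` from `x`. -/
noncomputable def sphereSum [Fintype V] (G : SimpleGraph V) (i : ℕ) (f : V → ℝ) (x : V) : ℝ :=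
  ∑ y, if G.dist x y = i then f y else 0

/-- The absolute values of the cosine sequence of the eigenvalue `-[D]`. -/
noncomputable def absCosine (b : ℕ) (α β : ℝ) : ℕ → ℝ
  | 0 => 1
  | i + 1 => absCosine b α β i * (1 + α * gauss b i) / (β - α * gauss b i)

/-- The cosine sequence of the eigenvalue `-[D]`. -/
noncomputable def cosine (b : ℕ) (α β : ℝ) (i : ℕ) : ℝ := (-1) ^ i * absCosine b α β i

section General

variable [Fintype V] {G : SimpleGraph V}

lemma sum_ite_const_eq_ncard (P : V → Prop) [DecidablePred P] (t : ℝ) :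
    (∑ y, if P y then t else 0) = ({y | P y}.ncard : ℝ) * t := by
  rw [← Finset.sum_filter, Finset.sum_const, nsmul_eq_mul, Set.ncard_eq_toFinset_card']
  simp

lemma setSum_one (ℓ : Set V) : setSum ℓ (fun _ => 1) = ℓ.ncard := by
  unfold setSum
  rw [sum_ite_const_eq_ncard]
  simp

open scoped Classical in
lemma sum_mul_nbrSum_comm (f g : V → ℝ) :
    ∑ x, f x * nbrSum G g x = ∑ x, g x * nbrSum G f x := by
  simp only [nbrSum, Finset.mul_sum]
  rw [Finset.sum_comm]
  refine Finset.sum_congr rfl fun y _ => Finset.sum_congr rfl fun x _ => ?_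
  by_cases h : G.Adj x y
  · simp [h, h.symm, mul_comm]
  · have h' : ¬ G.Adj y x := fun h' => h h'.symm
    simp [h, h']

open scoped Classical in
/-- A symmetric operator whose eigenvalues are at least `-r` has quadratic form bounded below
by `-r`. -/
lemma quadratic_form_nonneg_of_eigenvalues {r : ℝ}
    (h : ∀ (θ : ℝ) (f : V → ℝ), f ≠ 0 → (∀ x, nbrSum G f x = θ * f x) → -r ≤ θ) (f : V → ℝ) :
    0 ≤ ∑ x, f x * nbrSum G f x + r * ∑ x, f x ^ 2 := by
  have hmv : ∀ g : V → ℝ, (G.adjMatrix ℝ + r • (1 : Matrix V V ℝ)).mulVec g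
      = fun x => nbrSum G g x + r * g x := by
    intro g
    ext x
    rw [Matrix.add_mulVec, Matrix.smul_mulVec, Matrix.one_mulVec]
    simp [nbrSum, Matrix.mulVec, dotProduct, SimpleGraph.adjMatrix_apply]
  have hH : (G.adjMatrix ℝ + r • (1 : Matrix V V ℝ)).IsHermitian := by
    ext x y
    simp [SimpleGraph.adjMatrix_apply, G.adj_comm, Matrix.one_apply, eq_comm]
  have hP : (G.adjMatrix ℝ + r • (1 : Matrix V V ℝ)).PosSemidef := by
    rw [hH.posSemidef_iff_eigenvalues_nonneg]
    intro i
    have hv := hH.mulVec_eigenvectorBasis i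
    rw [hmv] at hv
    have hne : (hH.eigenvectorBasis i).ofLp ≠ 0 := by
      intro h0
      apply hH.eigenvectorBasis.orthonormal.ne_zero i
      ext x
      exact congrFun h0 x
    have := h (hH.eigenvalues i - r) _ hne (fun x => by
      have := congrFun hv x
      simp only [Pi.smul_apply, smul_eq_mul] at this
      linarith)
    simp only [Pi.zero_apply]
    linarith
  have := hP.dotProduct_mulVec_nonneg f
  rw [hmv] at this
  simp only [dotProduct, star_trivial] at this
  calc (0 : ℝ) ≤ _ := this
    _ = _ := by
      rw [Finset.mul_sum, ← Finset.sum_add_distrib]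
      exact Finset.sum_congr rfl fun x _ => by ring

end General

section PointGraph

variable [Fintype V] {G : SimpleGraph V} {L : Set (Set V)}

open scoped Classical in
/-- In a point graph whose lines are cliques, summing over the lines through `x` counts `x` once
for each line and each neighbour of `x` once. -/
lemma sum_lines_through (hcl : ∀ ℓ ∈ L, G.IsClique ℓ) (hpg : IsPointGraphOf G L)
    (g : V → ℝ) (x : V) :
    ∑ ℓ ∈ L.toFinset with x ∈ ℓ, setSum ℓ g
      = ({ℓ ∈ L | x ∈ ℓ}.ncard : ℝ) * g x + nbrSum G g x := by
  have hcount : ∀ z, (∑ ℓ ∈ L.toFinset with x ∈ ℓ, if z ∈ ℓ then g z else 0)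
      = (if z = x then ({ℓ ∈ L | x ∈ ℓ}.ncard : ℝ) * g x else 0)
        + if G.Adj x z then g z else 0 := by
    intro z
    by_cases hzx : z = x
    · subst hzx
      rw [Finset.sum_congr rfl (fun ℓ hℓ => if_pos (Finset.mem_filter.mp hℓ).2),
        Finset.sum_const, nsmul_eq_mul, Set.ncard_eq_toFinset_card']
      simp only [SimpleGraph.irrefl, if_true, if_false, add_zero]
      congr 3
      ext ℓ
      simp
    by_cases hadj : G.Adj x z
    · obtain ⟨ℓ₀, ⟨h1, h2, h3⟩, huniq⟩ := hpg x z hadj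
      rw [Finset.sum_eq_single_of_mem ℓ₀ (by simp [h1, h2])]
      · simp [h3, hzx, hadj]
      · intro ℓ hℓ hne
        simp only [Finset.mem_filter, Set.mem_toFinset] at hℓ
        rw [if_neg]
        exact fun hz => hne (huniq ℓ ⟨hℓ.1, hℓ.2, hz⟩)
    · simp only [hzx, hadj, if_false, add_zero]
      refine Finset.sum_eq_zero fun ℓ hℓ => ?_
      simp only [Finset.mem_filter, Set.mem_toFinset] at hℓ
      rw [if_neg]
      exact fun hz => hadj (hcl ℓ hℓ.1 hℓ.2 hz (Ne.symm hzx))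
  simp only [setSum, nbrSum]
  rw [Finset.sum_comm, Finset.sum_congr rfl (fun z _ => hcount z), Finset.sum_add_distrib]
  simp

open scoped Classical in
lemma sum_sq_setSum (hcl : ∀ ℓ ∈ L, G.IsClique ℓ) (hpg : IsPointGraphOf G L) (f : V → ℝ) :
    ∑ ℓ ∈ L.toFinset, setSum ℓ f ^ 2
      = ∑ x, f x * nbrSum G f x + ∑ x, ({ℓ ∈ L | x ∈ ℓ}.ncard : ℝ) * f x ^ 2 := by
  have h1 : ∀ ℓ : Set V, setSum ℓ f ^ 2 = ∑ x, f x * if x ∈ ℓ then setSum ℓ f else 0 := by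
    intro ℓ
    rw [sq]
    nth_rewrite 1 [setSum]
    rw [Finset.sum_mul]
    exact Finset.sum_congr rfl fun x _ => by split_ifs <;> simp
  simp only [h1]
  rw [Finset.sum_comm, ← Finset.sum_add_distrib]
  refine Finset.sum_congr rfl fun x _ => ?_
  rw [← Finset.mul_sum, ← Finset.sum_filter, sum_lines_through hcl hpg]
  ring

open scoped Classical in
/-- Counting incident point-line pairs. -/
lemma sum_ncard_lines : ∑ ℓ ∈ L.toFinset, (ℓ.ncard : ℝ) = ∑ x, ({ℓ ∈ L | x ∈ ℓ}.ncard : ℝ) := by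
  rw [Finset.sum_congr rfl fun ℓ _ => (setSum_one ℓ).symm]
  simp only [setSum]
  rw [Finset.sum_comm]
  refine Finset.sum_congr rfl fun x _ => ?_
  rw [← Finset.sum_filter, Finset.sum_const, nsmul_eq_mul, mul_one, Set.ncard_eq_toFinset_card']
  congr 2
  ext ℓ
  simp

/-- If `A + r` is positive semidefinite and every vertex lies on at least `r` lines, then there
are at most as many vertices on more than `r` lines as there are lines. -/
lemma ncard_le_ncard_lines (hcl : ∀ ℓ ∈ L, G.IsClique ℓ) (hpg : IsPointGraphOf G L) {r : ℝ}
    (hpsd : ∀ f : V → ℝ, 0 ≤ ∑ x, f x * nbrSum G f x + r * ∑ x, f x ^ 2) (B : Set V)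
    (hr : ∀ x, r ≤ ({ℓ ∈ L | x ∈ ℓ}.ncard : ℝ))
    (hB : ∀ x ∈ B, r < ({ℓ ∈ L | x ∈ ℓ}.ncard : ℝ)) : B.ncard ≤ L.ncard := by
  classical
  by_contra! hlt
  let T : (B → ℝ) →ₗ[ℝ] (L → ℝ) :=
    { toFun := fun f ℓ => ∑ x : B, if (x : V) ∈ (ℓ : Set V) then f x else 0
      map_add' := by
        intro f g
        ext ℓ
        simp only [Pi.add_apply]
        rw [← Finset.sum_add_distrib]
        exact Finset.sum_congr rfl fun x _ => by split_ifs <;> simp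
      map_smul' := by
        intro c f
        ext ℓ
        simp [Finset.mul_sum] }
  have hker : LinearMap.ker T ≠ ⊥ := by
    apply LinearMap.ker_ne_bot_of_finrank_lt
    simpa [Module.finrank_fintype_fun_eq_card, ← Nat.card_eq_fintype_card,
      Nat.card_coe_set_eq] using hlt
  obtain ⟨f, hf, hf0⟩ := (Submodule.ne_bot_iff _).mp hker
  rw [LinearMap.mem_ker] at hf
  let F : V → ℝ := fun x => if hx : x ∈ B then f ⟨x, hx⟩ else 0
  have hFB : ∀ x : B, F x = f x := fun x => by simp [F]
  have hFz : ∀ x, x ∉ B → F x = 0 := fun x hx => by simp [F, hx]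
  have hzero : ∀ ℓ ∈ L, setSum ℓ F = 0 := by
    intro ℓ hℓ
    have := congrFun hf ⟨ℓ, hℓ⟩
    simp only [T, LinearMap.coe_mk, AddHom.coe_mk, Pi.zero_apply] at this
    rw [← this, setSum, ← Finset.sum_subset (Finset.subset_univ B.toFinset)]
    · rw [← Finset.sum_coe_sort]
      refine Fintype.sum_equiv (Equiv.subtypeEquivRight (by simp)) _ _ fun x => ?_
      have hx : (x : V) ∈ B := Set.mem_toFinset.mp x.2
      simp only [F, hx, dif_pos]
      rfl
    · intro x _ hx
      rw [hFz x (by simpa using hx)]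
      simp
  have hsq := sum_sq_setSum hcl hpg F
  rw [Finset.sum_eq_zero (fun ℓ hℓ => by rw [hzero ℓ (by simpa using hℓ)]; simp)] at hsq
  have hpos : 0 < ∑ x, (({ℓ ∈ L | x ∈ ℓ}.ncard : ℝ) - r) * F x ^ 2 := by
    obtain ⟨x, hx⟩ := Function.ne_iff.mp hf0
    refine Finset.sum_pos' (fun y _ => mul_nonneg (sub_nonneg.2 (hr y)) (sq_nonneg _))
      ⟨x, Finset.mem_univ _, mul_pos (sub_pos.2 (hB x x.2)) ?_⟩
    rw [hFB]
    exact sq_pos_of_ne_zero hx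
  have := hpsd F
  simp only [sub_mul, Finset.sum_sub_distrib, ← Finset.mul_sum] at hpos
  linarith

end PointGraph

section DistanceRegular

variable {G : SimpleGraph V} {D : ℕ} {cc aa bb : ℕ → ℕ}

lemma exists_adj_dist_eq_of_dist_eq_succ (hG : G.Connected) {x y : V} {i : ℕ}
    (h : G.dist x y = i + 1) : ∃ z, G.Adj y z ∧ G.dist x z = i := by
  obtain ⟨p, hp⟩ := hG.exists_walk_length_eq_dist y x
  rw [SimpleGraph.dist_comm, h] at hp
  cases p with
  | nil => simp at hp
  | @cons _ z _ hadj q =>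
    refine ⟨z, hadj, ?_⟩
    have h1 : G.dist z x ≤ q.length := SimpleGraph.dist_le q
    have h2 : G.dist x y ≤ G.dist x z + G.dist z y := hG.dist_triangle
    have h3 : G.dist z y = 1 := SimpleGraph.dist_eq_one_iff_adj.mpr hadj.symm
    rw [SimpleGraph.Walk.length_cons] at hp
    rw [SimpleGraph.dist_comm] at h1
    omega

variable [Fintype V]

namespace IsDRG

lemma exists_dist_eq (h : IsDRG G D cc aa bb) {i : ℕ} (hi : i ≤ D) :
    ∃ x y : V, G.dist x y = i := by
  induction hi using Nat.decreasingInduction with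
  | self => exact h.2.2.1
  | of_succ k _ ih =>
    obtain ⟨x, y, hxy⟩ := ih
    obtain ⟨z, _, hz⟩ := exists_adj_dist_eq_of_dist_eq_succ h.1 hxy
    exact ⟨x, z, hz⟩

lemma cc_succ_pos (h : IsDRG G D cc aa bb) {i : ℕ} (hi : i < D) : 0 < cc (i + 1) := by
  obtain ⟨x, y, hxy⟩ := h.exists_dist_eq (Nat.succ_le_of_lt hi)
  obtain ⟨z, hz⟩ := exists_adj_dist_eq_of_dist_eq_succ h.1 hxy
  rw [← (h.2.2.2 (i + 1) hi x y hxy).1, Set.ncard_pos]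
  exact ⟨z, by simpa using hz⟩

lemma bb_pos (h : IsDRG G D cc aa bb) {i : ℕ} (hi : i < D) : 0 < bb i := by
  obtain ⟨x, y, hxy⟩ := h.exists_dist_eq (Nat.succ_le_of_lt hi)
  obtain ⟨z, hz, hxz⟩ := exists_adj_dist_eq_of_dist_eq_succ h.1 hxy
  rw [← (h.2.2.2 i hi.le x z hxz).2.2, Set.ncard_pos]
  exact ⟨y, hz.symm, hxy⟩

lemma cc_zero (h : IsDRG G D cc aa bb) : cc 0 = 0 := by
  obtain ⟨x, _⟩ := h.exists_dist_eq (Nat.zero_le D)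
  rw [← (h.2.2.2 0 (Nat.zero_le D) x x SimpleGraph.dist_self).1, Set.ncard_eq_zero,
    Set.eq_empty_iff_forall_notMem]
  rintro z ⟨hz, hd⟩
  rw [SimpleGraph.dist_eq_one_iff_adj.mpr hz] at hd
  simp at hd

lemma aa_zero (h : IsDRG G D cc aa bb) : aa 0 = 0 := by
  obtain ⟨x, _⟩ := h.exists_dist_eq (Nat.zero_le D)
  rw [← (h.2.2.2 0 (Nat.zero_le D) x x SimpleGraph.dist_self).2.1, Set.ncard_eq_zero,
    Set.eq_empty_iff_forall_notMem]
  rintro z ⟨hz, hd⟩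
  rw [SimpleGraph.dist_eq_one_iff_adj.mpr hz] at hd
  simp at hd

lemma bb_diam (h : IsDRG G D cc aa bb) : bb D = 0 := by
  obtain ⟨x, y, hxy⟩ := h.exists_dist_eq le_rfl
  rw [← (h.2.2.2 D le_rfl x y hxy).2.2, Set.ncard_eq_zero, Set.eq_empty_iff_forall_notMem]
  rintro z ⟨_, hd⟩
  have := h.2.1 x z
  omega

/-- The action of the adjacency operator on functions of the distance from `x`. -/
lemma nbrSum_dist (h : IsDRG G D cc aa bb) (w : ℕ → ℝ) (x z : V) :
    nbrSum G (fun y => w (G.dist x y)) z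
      = cc (G.dist x z) * w (G.dist x z - 1) + aa (G.dist x z) * w (G.dist x z)
        + bb (G.dist x z) * w (G.dist x z + 1) := by
  classical
  obtain ⟨hc, ha, hb⟩ := h.2.2.2 _ (h.2.1 x z) x z rfl
  rw [← hc, ← ha, ← hb]
  simp only [← sum_ite_const_eq_ncard]
  rw [← Finset.sum_add_distrib, ← Finset.sum_add_distrib, nbrSum]
  refine Finset.sum_congr rfl fun y _ => ?_
  by_cases hadj : G.Adj z y
  · have h1 : G.dist z y = 1 := SimpleGraph.dist_eq_one_iff_adj.mpr hadj
    have h2 : G.dist x y ≤ G.dist x z + G.dist z y := h.1.dist_triangle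
    have h3 : G.dist x z ≤ G.dist x y + G.dist y z := h.1.dist_triangle
    have h4 : G.dist z y ≤ G.dist z x + G.dist x y := h.1.dist_triangle
    rw [G.dist_comm (u := y)] at h3
    rw [G.dist_comm (u := z) (v := x)] at h4
    simp only [hadj, true_and, if_true]
    have : (G.dist x y + 1 = G.dist x z) ∨ (G.dist x y = G.dist x z ∧ 0 < G.dist x z)
        ∨ G.dist x y = G.dist x z + 1 := by omega
    rcases this with h5 | h5 | h5
    · rw [if_pos (by omega), if_neg (by omega), if_neg (by omega), ← h5]
      simp
    · rw [if_neg (by omega), if_pos (by omega), if_neg (by omega), h5.1]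
      simp
    · rw [if_neg (by omega), if_neg (by omega), if_pos (by omega), h5]
      simp
  · simp [hadj]

lemma sum_dist_mul_nbrSum (h : IsDRG G D cc aa bb) (w : ℕ → ℝ) (f : V → ℝ) (x : V) :
    ∑ y, w (G.dist x y) * nbrSum G f y
      = ∑ z, f z * (cc (G.dist x z) * w (G.dist x z - 1) + aa (G.dist x z) * w (G.dist x z)
        + bb (G.dist x z) * w (G.dist x z + 1)) := by
  rw [sum_mul_nbrSum_comm (fun y => w (G.dist x y)) f]
  simp only [h.nbrSum_dist]

lemma nbrSum_one (h : IsDRG G D cc aa bb) (x : V) : nbrSum G (fun _ => 1) x = bb 0 := by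
  have := h.nbrSum_dist (fun _ => 1) x x
  simpa [h.cc_zero, h.aa_zero] using this

lemma cc_add_aa_add_bb (h : IsDRG G D cc aa bb) {i : ℕ} (hi : i ≤ D) :
    (cc i + aa i + bb i : ℝ) = bb 0 := by
  obtain ⟨x, y, hxy⟩ := h.exists_dist_eq hi
  have := h.nbrSum_dist (fun _ => 1) x y
  rw [h.nbrSum_one, hxy] at this
  linarith

lemma exists_adj_dist_eq_succ (h : IsDRG G D cc aa bb) {x y : V} {i : ℕ} (hi : i < D)
    (hxy : G.dist x y = i) : ∃ z, G.Adj y z ∧ G.dist x z = i + 1 := by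
  have := h.bb_pos hi
  rw [← (h.2.2.2 i hi.le x y hxy).2.2, Set.ncard_pos] at this
  exact this

open scoped Classical in
lemma sum_mul_dist (h : IsDRG G D cc aa bb) (w : ℕ → ℝ) (f : V → ℝ) (x : V) :
    ∑ y, f y * w (G.dist x y) = ∑ i ∈ Finset.range (D + 1), sphereSum G i f x * w i := by
  simp only [sphereSum, Finset.sum_mul]
  rw [Finset.sum_comm]
  refine Finset.sum_congr rfl fun y _ => ?_
  rw [Finset.sum_eq_single_of_mem (G.dist x y)
    (Finset.mem_range.2 (Nat.lt_succ_of_le (h.2.1 x y)))]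
  · simp
  · intro i _ hi
    simp [Ne.symm hi]

lemma sphereSum_zero (h : IsDRG G D cc aa bb) (f : V → ℝ) (x : V) :
    sphereSum G 0 f x = f x := by
  classical
  rw [sphereSum, Finset.sum_eq_single_of_mem x (Finset.mem_univ x)]
  · simp
  · intro y _ hy
    exact if_neg fun e => hy (h.1.dist_eq_zero_iff.mp e).symm

/-- The three-term recurrence of the distance operators on an eigenfunction. -/
lemma sphereSum_recurrence (h : IsDRG G D cc aa bb) {θ : ℝ} {f : V → ℝ}
    (hf : ∀ x, nbrSum G f x = θ * f x) (x : V) (i : ℕ) :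
    θ * sphereSum G i f x = cc (i + 1) * sphereSum G (i + 1) f x + aa i * sphereSum G i f x
      + (if i = 0 then 0 else bb (i - 1) * sphereSum G (i - 1) f x) := by
  classical
  have key := h.sum_dist_mul_nbrSum (fun j => if j = i then 1 else 0) f x
  simp only [hf] at key
  have hl : θ * sphereSum G i f x
      = ∑ y, (if G.dist x y = i then (1 : ℝ) else 0) * (θ * f y) := by
    rw [sphereSum, Finset.mul_sum]
    exact Finset.sum_congr rfl fun y _ => by split_ifs <;> simp
  rw [hl, key]
  have h3 : (if i = 0 then (0 : ℝ) else bb (i - 1) * sphereSum G (i - 1) f x)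
      = ∑ z, if G.dist x z + 1 = i then bb (i - 1) * f z else 0 := by
    rcases i with _ | i
    · simp
    · simp [sphereSum, Finset.mul_sum]
  rw [h3]
  simp only [sphereSum, Finset.mul_sum]
  rw [← Finset.sum_add_distrib, ← Finset.sum_add_distrib]
  refine Finset.sum_congr rfl fun z _ => ?_
  generalize G.dist x z = d
  have hc0 : (cc 0 : ℝ) = 0 := by exact_mod_cast h.cc_zero
  rcases d with _ | d
  · rcases i with _ | i
    · simp [hc0, mul_comm]
    · rcases i with _ | i <;> simp [hc0, mul_comm]
  · by_cases h1 : d = i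
    · subst h1
      rw [if_neg (by omega : ¬ d + 1 + 1 = d), if_neg (by omega : ¬ d + 1 + 1 = d)]
      simp [mul_comm]
    by_cases h2 : d + 1 = i
    · subst h2
      simp [mul_comm]
    by_cases h4 : d + 1 + 1 = i
    · subst h4
      rw [if_neg (by omega : ¬ d + 1 - 1 = d + 1 + 1)]
      simp [mul_comm]
    simp [h1, h2, h4]

/-- The distance operators act as scalars on each eigenspace of the adjacency operator. -/
lemma exists_sphereSum_eq_mul (h : IsDRG G D cc aa bb) (θ : ℝ) {i : ℕ} (hi : i ≤ D) :
    ∃ w : ℝ, ∀ f : V → ℝ, (∀ x, nbrSum G f x = θ * f x) → ∀ x, sphereSum G i f x = w * f x := by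
  induction i using Nat.strong_induction_on with
  | _ i ih =>
    rcases i with _ | i
    · exact ⟨1, fun f _ x => by rw [h.sphereSum_zero, one_mul]⟩
    obtain ⟨w₁, hw₁⟩ := ih i (by omega) (by omega)
    obtain ⟨w₀, hw₀⟩ : ∃ w : ℝ, ∀ f : V → ℝ, (∀ x, nbrSum G f x = θ * f x) → ∀ x,
        (if i = 0 then 0 else bb (i - 1) * sphereSum G (i - 1) f x) = w * f x := by
      by_cases h0 : i = 0
      · exact ⟨0, fun f _ x => by simp [h0]⟩
      · obtain ⟨w, hw⟩ := ih (i - 1) (by omega) (by omega)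
        exact ⟨bb (i - 1) * w, fun f hf x => by rw [if_neg h0, hw f hf]; ring⟩
    have hc : (cc (i + 1) : ℝ) ≠ 0 := by
      exact_mod_cast (h.cc_succ_pos (Nat.lt_of_succ_le hi)).ne'
    refine ⟨((θ - aa i) * w₁ - w₀) / cc (i + 1), fun f hf x => ?_⟩
    have := h.sphereSum_recurrence hf x i
    rw [hw₁ f hf, hw₀ f hf] at this
    field_simp
    linarith

/-- A function of the distance acts as a scalar on each eigenspace of the adjacency operator. -/
lemma exists_sum_dist_eq_mul (h : IsDRG G D cc aa bb) (θ : ℝ) (u : ℕ → ℝ) :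
    ∃ c : ℝ, ∀ f : V → ℝ, (∀ x, nbrSum G f x = θ * f x) →
      ∀ x, ∑ y, f y * u (G.dist x y) = c * f x := by
  have hw : ∀ i, ∃ w : ℝ, i ≤ D → ∀ f : V → ℝ, (∀ x, nbrSum G f x = θ * f x) →
      ∀ x, sphereSum G i f x = w * f x := fun i => by
    by_cases hi : i ≤ D
    · obtain ⟨w, hw⟩ := h.exists_sphereSum_eq_mul θ hi
      exact ⟨w, fun _ => hw⟩
    · exact ⟨0, fun hi' => absurd hi' hi⟩
  choose w hw using hw
  refine ⟨∑ i ∈ Finset.range (D + 1), w i * u i, fun f hf x => ?_⟩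
  rw [h.sum_mul_dist, Finset.sum_mul]
  refine Finset.sum_congr rfl fun i hi => ?_
  rw [hw i (Nat.lt_succ_iff.mp (Finset.mem_range.1 hi)) f hf]
  ring

end IsDRG

end DistanceRegular

section Classical

variable {b : ℕ}

@[simp]
lemma gauss_zero : gauss b 0 = 0 := by simp [gauss]

@[simp]
lemma gauss_one : gauss b 1 = 1 := by simp [gauss]

lemma gauss_two : gauss b 2 = 1 + b := by simp [gauss, Finset.sum_range_succ]

lemma gauss_strictMono (hb : 2 ≤ b) : StrictMono (gauss b) := by
  refine strictMono_nat_of_lt_succ fun i => ?_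
  rw [gauss, gauss, Finset.sum_range_succ]
  have : (0 : ℝ) < (b : ℝ) ^ i := by positivity
  linarith

variable [Fintype V] {G : SimpleGraph V} {D : ℕ} {α β : ℝ} {cc aa bb : ℕ → ℕ}

namespace HasClassicalParams

lemma one_add_pos (h : HasClassicalParams G D b α β cc aa bb) (hb : 2 ≤ b) {i : ℕ}
    (hi : i < D) : 0 < 1 + α * gauss b i := by
  have h1 := h.2.2 (i + 1) (by omega) hi
  have h2 : (0 : ℝ) < cc (i + 1) := by exact_mod_cast h.1.cc_succ_pos hi
  have h3 : 0 < gauss b (i + 1) := gauss_zero (b := b) ▸ gauss_strictMono hb (Nat.succ_pos i)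
  rw [h1, Nat.add_sub_cancel] at h2
  exact (pos_iff_pos_of_mul_pos h2).1 h3

lemma sub_pos (h : HasClassicalParams G D b α β cc aa bb) (hb : 2 ≤ b) {i : ℕ}
    (hi : i < D) : 0 < β - α * gauss b i := by
  have h1 := h.2.1 i (by omega)
  have h2 : (0 : ℝ) < bb i := by exact_mod_cast h.1.bb_pos hi
  have h3 := gauss_strictMono hb hi
  rw [h1] at h2
  exact (pos_iff_pos_of_mul_pos h2).1 (by linarith)

lemma beta_pos (h : HasClassicalParams G D b α β cc aa bb) (hb : 2 ≤ b) (hD : 0 < D) :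
    0 < β := by
  simpa using h.sub_pos hb hD

lemma bb_zero (h : HasClassicalParams G D b α β cc aa bb) : (bb 0 : ℝ) = gauss b D * β := by
  simpa using h.2.1 0 (Nat.zero_le _)

lemma absCosine_pos (h : HasClassicalParams G D b α β cc aa bb) (hb : 2 ≤ b) {i : ℕ}
    (hi : i ≤ D) : 0 < absCosine b α β i := by
  induction i with
  | zero => exact one_pos
  | succ i ih => exact div_pos (mul_pos (ih (by omega)) (h.one_add_pos hb hi)) (h.sub_pos hb hi)

/-- The three-term recurrence of the cosine sequence, in terms of absolute values. -/
lemma absCosine_recurrence (h : HasClassicalParams G D b α β cc aa bb) (hb : 2 ≤ b) {i : ℕ}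
    (hi : i ≤ D) :
    aa i * absCosine b α β i - cc i * absCosine b α β (i - 1) - bb i * absCosine b α β (i + 1)
      = -gauss b D * absCosine b α β i := by
  have hbb : (bb i : ℝ) = (gauss b D - gauss b i) * (β - α * gauss b i) := by
    rcases hi.lt_or_eq with hlt | rfl
    · exact h.2.1 i (by omega)
    · simp [h.1.bb_diam]
  have hcc : (cc i : ℝ) = gauss b i * (1 + α * gauss b (i - 1)) := by
    rcases i with _ | i
    · simp [h.1.cc_zero]
    · exact h.2.2 (i + 1) (by omega) hi
  have hbp : bb i * absCosine b α β (i + 1)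
      = (gauss b D - gauss b i) * (1 + α * gauss b i) * absCosine b α β i := by
    rcases hi.lt_or_eq with hlt | rfl
    · have := (h.sub_pos hb hlt).ne'
      rw [hbb, absCosine, mul_assoc, mul_div_cancel₀ _ this]
      ring
    · simp [h.1.bb_diam]
  have hcp : cc i * absCosine b α β (i - 1)
      = gauss b i * (β - α * gauss b (i - 1)) * absCosine b α β i := by
    rcases i with _ | i
    · simp [h.1.cc_zero]
    · have := (h.sub_pos hb hi).ne'
      rw [hcc, Nat.add_sub_cancel, absCosine]
      field_simp
  have haa := h.1.cc_add_aa_add_bb hi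
  rw [h.bb_zero] at haa
  have haa' : (aa i : ℝ) = gauss b D * β - cc i - bb i := by linarith
  rw [hbp, hcp, haa', hcc, hbb]
  ring

lemma cosine_recurrence (h : HasClassicalParams G D b α β cc aa bb) (hb : 2 ≤ b) {i : ℕ}
    (hi : i ≤ D) :
    cc i * cosine b α β (i - 1) + aa i * cosine b α β i + bb i * cosine b α β (i + 1)
      = -gauss b D * cosine b α β i := by
  have hrec := h.absCosine_recurrence hb hi
  rcases i with _ | i
  · simp only [cosine, h.1.cc_zero, pow_zero, zero_add, pow_one] at hrec ⊢
    push_cast at hrec ⊢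
    linarith
  · simp only [cosine, Nat.add_sub_cancel, pow_succ] at hrec ⊢
    linear_combination (-1) ^ i * (-1) * hrec

/-- The functions `y ↦ u (d (x, y))` are eigenfunctions for `-[D]`. -/
lemma nbrSum_cosine (h : HasClassicalParams G D b α β cc aa bb) (hb : 2 ≤ b) (x z : V) :
    nbrSum G (fun y => cosine b α β (G.dist x y)) z
      = -gauss b D * cosine b α β (G.dist x z) := by
  rw [h.1.nbrSum_dist, h.cosine_recurrence hb (h.1.2.1 x z)]

/-- The cosine matrix is a positive multiple of an idempotent. -/
lemma exists_cosine_mul_cosine (h : HasClassicalParams G D b α β cc aa bb) (hb : 2 ≤ b) :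
    ∃ c : ℝ, 0 < c ∧ ∀ x z : V,
      ∑ y, cosine b α β (G.dist z y) * cosine b α β (G.dist x y)
        = c * cosine b α β (G.dist z x) := by
  obtain ⟨c, hc⟩ := h.1.exists_sum_dist_eq_mul (-gauss b D) (cosine b α β)
  have hc' : ∀ x z : V, ∑ y, cosine b α β (G.dist z y) * cosine b α β (G.dist x y)
      = c * cosine b α β (G.dist z x) :=
    fun x z => hc _ (fun y => h.nbrSum_cosine hb z y) x
  refine ⟨c, ?_, hc'⟩
  obtain ⟨x, _⟩ := h.1.exists_dist_eq (Nat.zero_le D)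
  have hx := hc' x x
  have h0 : cosine b α β (G.dist x x) = 1 := by simp [cosine, absCosine]
  rw [h0, mul_one] at hx
  rw [← hx]
  refine Finset.sum_pos' (fun y _ => mul_self_nonneg _) ⟨x, Finset.mem_univ _, ?_⟩
  rw [h0]
  norm_num

/-- The smallest eigenvalue is `-[D]`. -/
lemma neg_gauss_le_eigenvalue (h : HasClassicalParams G D b α β cc aa bb) (hb : 2 ≤ b) {θ : ℝ}
    {f : V → ℝ} (hf0 : f ≠ 0) (hf : ∀ x, nbrSum G f x = θ * f x) : -gauss b D ≤ θ := by
  classical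
  obtain ⟨x, hx⟩ := Function.ne_iff.mp hf0
  set p := absCosine b α β with hp
  set F : ℕ → ℝ := fun i => sphereSum G i f x with hF
  let w : ℕ → ℝ := fun i => if 0 ≤ F i then p i else -p i
  have hw : ∀ i, F i * w i = |F i| * p i := by
    intro i
    by_cases hi : 0 ≤ F i
    · simp [w, hi, abs_of_nonneg hi]
    · simp [w, hi, abs_of_neg (not_le.1 hi)]
  have hwabs : ∀ i, |w i| = |p i| := fun i => by
    simp only [w]
    split_ifs <;> simp
  have key := h.1.sum_dist_mul_nbrSum w f x
  have hl : ∑ y, w (G.dist x y) * nbrSum G f y = θ * ∑ y, f y * w (G.dist x y) := by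
    rw [Finset.mul_sum]
    exact Finset.sum_congr rfl fun y _ => by rw [hf]; ring
  rw [hl, h.1.sum_mul_dist,
    h.1.sum_mul_dist (fun i => cc i * w (i - 1) + aa i * w i + bb i * w (i + 1))] at key
  have hpos : 0 < ∑ i ∈ Finset.range (D + 1), |F i| * p i := by
    refine Finset.sum_pos' (fun i hi => mul_nonneg (abs_nonneg _)
      (h.absCosine_pos hb (Nat.lt_succ_iff.mp (Finset.mem_range.1 hi))).le) ⟨0, by simp, ?_⟩
    refine mul_pos (abs_pos.2 ?_) (h.absCosine_pos hb (Nat.zero_le D))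
    simpa [hF, h.1.sphereSum_zero] using hx
  have hge : ∑ i ∈ Finset.range (D + 1), -gauss b D * (|F i| * p i)
      ≤ ∑ i ∈ Finset.range (D + 1),
        F i * (cc i * w (i - 1) + aa i * w i + bb i * w (i + 1)) := by
    refine Finset.sum_le_sum fun i hi => ?_
    have hi : i ≤ D := Nat.lt_succ_iff.mp (Finset.mem_range.1 hi)
    have hrec := h.absCosine_recurrence hb hi
    have hbound : ∀ j ≤ D, -(|F i| * p j) ≤ F i * w j := by
      intro j hj
      have hpj : |w j| = p j := (hwabs j).trans (abs_of_pos (h.absCosine_pos hb hj))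
      rw [← hpj, ← abs_mul]
      exact neg_abs_le _
    have hc : -(cc i * (|F i| * p (i - 1))) ≤ cc i * (F i * w (i - 1)) := by
      have := mul_le_mul_of_nonneg_left (hbound (i - 1) (by omega)) (Nat.cast_nonneg (α := ℝ) (cc i))
      linarith
    have hb' : -(bb i * (|F i| * p (i + 1))) ≤ bb i * (F i * w (i + 1)) := by
      rcases hi.lt_or_eq with hlt | rfl
      · have := mul_le_mul_of_nonneg_left (hbound (i + 1) hlt) (Nat.cast_nonneg (α := ℝ) (bb i))
        linarith
      · simp [h.1.bb_diam]
    calc -gauss b D * (|F i| * p i)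
        = |F i| * (aa i * p i - cc i * p (i - 1) - bb i * p (i + 1)) := by rw [hrec]; ring
      _ = aa i * (F i * w i) - cc i * (|F i| * p (i - 1)) - bb i * (|F i| * p (i + 1)) := by
        rw [hw]; ring
      _ ≤ _ := by linarith
  rw [← Finset.mul_sum, ← key] at hge
  have hs : ∑ i ∈ Finset.range (D + 1), sphereSum G i f x * w i
      = ∑ i ∈ Finset.range (D + 1), |F i| * p i := Finset.sum_congr rfl fun i _ => hw i
  rw [hs] at hge
  exact le_of_mul_le_mul_right hge hpos

lemma cosine_zero : cosine b α β 0 = 1 := by simp [cosine, absCosine]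

lemma cosine_one : cosine b α β 1 = -(1 / β) := by simp [cosine, absCosine]

lemma cosine_two : cosine b α β 2 = 1 / β * (1 + α) / (β - α) := by simp [cosine, absCosine]

lemma setSum_cosine_of_mem {C : Set V} (hC : G.IsClique C) {x : V} (hx : x ∈ C) :
    setSum C (fun y => cosine b α β (G.dist x y)) = 1 - ((C.ncard : ℝ) - 1) * (1 / β) := by
  classical
  have hpt : ∀ y, (if y ∈ C then cosine b α β (G.dist x y) else 0)
      = (if y ∈ C then -(1 / β) else 0) + if y = x then 1 + 1 / β else 0 := by
    intro y
    by_cases hy : y ∈ C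
    · by_cases hyx : y = x
      · subst hyx
        simp [hx, cosine_zero]
      · have := SimpleGraph.dist_eq_one_iff_adj.mpr (hC hx hy (Ne.symm hyx))
        simp [hy, hyx, this, cosine_one]
    · have hyx : y ≠ x := fun e => hy (e ▸ hx)
      simp [hy, hyx]
  rw [setSum, Finset.sum_congr rfl fun y _ => hpt y, Finset.sum_add_distrib,
    sum_ite_const_eq_ncard, Finset.sum_ite_eq' Finset.univ x]
  simp
  ring

lemma exists_sum_sq_setSum_cosine (h : HasClassicalParams G D b α β cc aa bb) (hb : 2 ≤ b) :
    ∃ c : ℝ, 0 < c ∧ ∀ C : Set V, G.IsClique C →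
      ∑ y, setSum C (fun x => cosine b α β (G.dist y x)) ^ 2
        = c * (C.ncard * (1 - ((C.ncard : ℝ) - 1) * (1 / β))) := by
  classical
  obtain ⟨c, hc, hcc⟩ := h.exists_cosine_mul_cosine hb
  refine ⟨c, hc, fun C hC => ?_⟩
  have h1 : ∀ y, setSum C (fun x => cosine b α β (G.dist y x)) ^ 2
      = ∑ x, if x ∈ C then
          (∑ z, if z ∈ C then cosine b α β (G.dist z y) * cosine b α β (G.dist x y) else 0)
        else 0 := by
    intro y
    rw [sq, setSum, Finset.sum_mul]
    refine Finset.sum_congr rfl fun x _ => ?_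
    split_ifs
    · rw [Finset.mul_sum]
      refine Finset.sum_congr rfl fun z _ => ?_
      split_ifs
      · rw [G.dist_comm (u := y) (v := z), G.dist_comm (u := y) (v := x), mul_comm]
      · simp
    · simp
  simp only [h1]
  rw [Finset.sum_comm]
  have h2 : ∀ x, (∑ y, if x ∈ C then
          (∑ z, if z ∈ C then cosine b α β (G.dist z y) * cosine b α β (G.dist x y) else 0)
        else 0) = if x ∈ C then c * (1 - ((C.ncard : ℝ) - 1) * (1 / β)) else 0 := by
    intro x
    by_cases hx : x ∈ C
    · simp only [hx, if_true]
      rw [Finset.sum_comm, ← setSum_cosine_of_mem (b := b) (α := α) hC hx, setSum, Finset.mul_sum]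
      refine Finset.sum_congr rfl fun z _ => ?_
      split_ifs
      · rw [hcc, G.dist_comm]
      · simp
    · simp [hx]
  simp only [h2]
  rw [sum_ite_const_eq_ncard]
  simp
  ring

/-- The Delsarte bound on cliques. -/
lemma ncard_clique_le (h : HasClassicalParams G D b α β cc aa bb) (hb : 2 ≤ b) (hD : 0 < D)
    {C : Set V} (hC : G.IsClique C) : (C.ncard : ℝ) ≤ β + 1 := by
  have hβ := h.beta_pos hb hD
  obtain ⟨c, hc, hcC⟩ := h.exists_sum_sq_setSum_cosine hb
  have hnn : 0 ≤ c * (C.ncard * (1 - ((C.ncard : ℝ) - 1) * (1 / β))) := by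
    rw [← hcC C hC]
    exact Finset.sum_nonneg fun _ _ => sq_nonneg _
  rcases (Nat.cast_nonneg (α := ℝ) C.ncard).eq_or_lt with h0 | h0
  · rw [← h0]
    linarith
  · have h1 := nonneg_of_mul_nonneg_right (nonneg_of_mul_nonneg_right hnn hc) h0
    have h2 : ((C.ncard : ℝ) - 1) * (1 / β) ≤ 1 := by linarith
    rw [mul_one_div, div_le_one hβ] at h2
    linarith

/-- A vertex outside a Delsarte clique with a neighbour in it has exactly `1 + α` neighbours
in it. -/
lemma ncard_adj_delsarte_clique (h : HasClassicalParams G D b α β cc aa bb) (hb : 2 ≤ b)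
    (hD : 2 ≤ D) {C : Set V} (hC : G.IsClique C) (hcard : (C.ncard : ℝ) = β + 1) {y : V}
    (hy : y ∉ C) (hnbr : ∃ z ∈ C, G.Adj y z) :
    ({z ∈ C | G.Adj y z}.ncard : ℝ) = 1 + α := by
  classical
  have hβ := h.beta_pos hb (by omega)
  have hβα : 0 < β - α := by simpa using h.sub_pos (i := 1) hb (by omega)
  obtain ⟨c, hc, hcC⟩ := h.exists_sum_sq_setSum_cosine hb
  have hzero := hcC C hC
  rw [hcard, add_sub_cancel_right, mul_one_div, div_self hβ.ne', sub_self, mul_zero, mul_zero,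
    Finset.sum_eq_zero_iff_of_nonneg (fun _ _ => sq_nonneg _)] at hzero
  have hy0 := pow_eq_zero_iff two_ne_zero |>.mp (hzero y (Finset.mem_univ y))
  obtain ⟨z₀, hz₀, hyz₀⟩ := hnbr
  have hpt : ∀ z, (if z ∈ C then cosine b α β (G.dist y z) else 0)
      = (if z ∈ C then cosine b α β 2 else 0)
        + if z ∈ C ∧ G.Adj y z then cosine b α β 1 - cosine b α β 2 else 0 := by
    intro z
    by_cases hz : z ∈ C
    · by_cases hyz : G.Adj y z
      · simp [hz, hyz, SimpleGraph.dist_eq_one_iff_adj.mpr hyz]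
      · have hd : G.dist y z = 2 := by
          have hne : z₀ ≠ z := fun e => hyz (e ▸ hyz₀)
          have h1 : G.dist y z ≤ G.dist y z₀ + G.dist z₀ z := h.1.1.dist_triangle
          rw [SimpleGraph.dist_eq_one_iff_adj.mpr hyz₀,
            SimpleGraph.dist_eq_one_iff_adj.mpr (hC hz₀ hz hne)] at h1
          have h2 : G.dist y z ≠ 0 := fun e => hy (h.1.1.dist_eq_zero_iff.mp e ▸ hz)
          have h3 : G.dist y z ≠ 1 := fun e => hyz (SimpleGraph.dist_eq_one_iff_adj.mp e)
          omega
        simp [hz, hyz, hd]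
    · simp [hz]
  rw [setSum, Finset.sum_congr rfl fun z _ => hpt z, Finset.sum_add_distrib,
    sum_ite_const_eq_ncard, sum_ite_const_eq_ncard, Set.ofPred_mem_eq, hcard, cosine_one,
    cosine_two] at hy0
  have hsc : (β + 1) * (1 + α - ({z ∈ C | G.Adj y z}.ncard : ℝ)) = 0 := by
    field_simp at hy0
    linear_combination hy0
  rcases mul_eq_zero.mp hsc with h1 | h1 <;> linarith

lemma two_lt_cc_two (h : HasClassicalParams G D b α β cc aa bb) (hb : 2 ≤ b) (hD : 3 ≤ D) :
    (2 : ℝ) < cc 2 := by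
  have h1 := h.one_add_pos hb (i := 2) (by omega)
  have h2 := h.2.2 2 (by omega) (by omega)
  have hb' : (2 : ℝ) ≤ b := by exact_mod_cast hb
  simp only [gauss_two, Nat.add_one_sub_one, gauss_one, mul_one] at h1 h2
  rw [h2]
  linarith

/-- The number of lines through a vertex is at least `[D]`, with equality only at Delsarte
vertices. -/
lemma gauss_le_ncard_lines {L : Set (Set V)} (h : HasClassicalParams G D b α β cc aa bb)
    (hb : 2 ≤ b) (hD : 0 < D) (hcl : ∀ ℓ ∈ L, G.IsClique ℓ) (hpg : IsPointGraphOf G L) (x : V) :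
    gauss b D ≤ ({ℓ ∈ L | x ∈ ℓ}.ncard : ℝ) ∧
      (¬ IsDelsarteVertex L β x → gauss b D < ({ℓ ∈ L | x ∈ ℓ}.ncard : ℝ)) := by
  classical
  have hβ := h.beta_pos hb hD
  have hsum := sum_lines_through hcl hpg (fun _ => 1) x
  rw [h.1.nbrSum_one, h.bb_zero] at hsum
  simp only [setSum_one] at hsum
  have hτ : ∑ ℓ ∈ L.toFinset with x ∈ ℓ, (β + 1) = ({ℓ ∈ L | x ∈ ℓ}.ncard : ℝ) * (β + 1) := by
    rw [Finset.sum_const, nsmul_eq_mul, Set.ncard_eq_toFinset_card']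
    congr 3
    ext ℓ
    simp
  have hle : ∀ ℓ ∈ L.toFinset.filter (x ∈ ·), (ℓ.ncard : ℝ) ≤ β + 1 := fun ℓ hℓ =>
    h.ncard_clique_le hb hD (hcl ℓ (by simpa using (Finset.mem_filter.mp hℓ).1))
  constructor
  · have := Finset.sum_le_sum hle
    rw [hsum, hτ] at this
    exact le_of_mul_le_mul_right (by linarith) hβ
  · intro hnd
    simp only [IsDelsarteVertex, not_forall] at hnd
    obtain ⟨ℓ, hℓ, hxℓ, hne⟩ := hnd
    have hmem : ℓ ∈ L.toFinset.filter (x ∈ ·) := by simp [hℓ, hxℓ]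
    have := Finset.sum_lt_sum hle ⟨ℓ, hmem, lt_of_le_of_ne (hle ℓ hmem) hne⟩
    rw [hsum, hτ] at this
    exact lt_of_mul_lt_mul_right (by linarith) hβ.le

/-- A Delsarte vertex has at least `b + 1` lines in `[x, y]` for every `y` at distance two. -/
lemma le_ncard_lineXY {L : Set (Set V)} (h : HasClassicalParams G D b α β cc aa bb)
    (hb : 2 ≤ b) (hD : 2 ≤ D) (hcl : ∀ ℓ ∈ L, G.IsClique ℓ) (hpg : IsPointGraphOf G L) {x y : V}
    (hx : IsDelsarteVertex L β x) (hxy : G.dist x y = 2) :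
    b + 1 ≤ (lineXY G L x y).ncard := by
  classical
  have hα : 0 < 1 + α := by simpa using h.one_add_pos (i := 1) hb (by omega)
  have hnadj : ¬ G.Adj y x := fun e => by
    rw [SimpleGraph.dist_comm, SimpleGraph.dist_eq_one_iff_adj.mpr e] at hxy
    omega
  have hsum := sum_lines_through hcl hpg (fun z => if G.Adj y z then 1 else 0) x
  have hc2 : nbrSum G (fun z => if G.Adj y z then 1 else 0) x = cc 2 := by
    rw [← (h.1.2.2.2 2 hD x y hxy).1, nbrSum]
    simp only [← ite_and]
    rw [sum_ite_const_eq_ncard, mul_one]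
    congr 2
    ext z
    simp [SimpleGraph.dist_eq_one_iff_adj, and_comm]
  rw [hc2, if_neg hnadj, mul_zero, zero_add, h.2.2 2 (by omega) hD] at hsum
  have hline : ∀ ℓ : Set V, setSum ℓ (fun z => if G.Adj y z then 1 else 0)
      = ({z ∈ ℓ | G.Adj y z}.ncard : ℝ) := by
    intro ℓ
    rw [setSum]
    simp only [← ite_and]
    rw [sum_ite_const_eq_ncard, mul_one]
  simp only [hline] at hsum
  have hle : ∑ ℓ ∈ L.toFinset with x ∈ ℓ, ({z ∈ ℓ | G.Adj y z}.ncard : ℝ)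
      ≤ ∑ ℓ ∈ L.toFinset with x ∈ ℓ, if ℓ ∈ lineXY G L x y then 1 + α else 0 := by
    refine Finset.sum_le_sum fun ℓ hℓ => ?_
    simp only [Finset.mem_filter, Set.mem_toFinset] at hℓ
    by_cases hn : ∃ z ∈ ℓ, G.Adj y z
    · have hyℓ : y ∉ ℓ := fun hy => hnadj (hcl ℓ hℓ.1 hy hℓ.2 fun e => by simp [e] at hxy)
      rw [h.ncard_adj_delsarte_clique hb hD (hcl ℓ hℓ.1) (hx ℓ hℓ.1 hℓ.2) hyℓ hn, if_pos]
      refine ⟨hℓ.1, hℓ.2, fun u hu => ?_⟩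
      obtain ⟨z, hz, hyz⟩ := hn
      have h1 : G.dist y u ≤ G.dist y z + G.dist z u := h.1.1.dist_triangle
      rw [SimpleGraph.dist_eq_one_iff_adj.mpr hyz] at h1
      by_cases hzu : z = u
      · subst hzu
        simp at h1
        omega
      · rw [SimpleGraph.dist_eq_one_iff_adj.mpr (hcl ℓ hℓ.1 hz hu hzu)] at h1
        exact h1
    · have : {z ∈ ℓ | G.Adj y z} = ∅ := by
        rw [Set.eq_empty_iff_forall_notMem]
        exact fun z hz => hn ⟨z, hz.1, hz.2⟩
      rw [this, Set.ncard_empty, Nat.cast_zero]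
      split_ifs <;> linarith
  have hcount : (∑ ℓ ∈ L.toFinset with x ∈ ℓ, if ℓ ∈ lineXY G L x y then 1 + α else 0)
      = ((lineXY G L x y).ncard : ℝ) * (1 + α) := by
    rw [← Finset.sum_filter, Finset.sum_const, nsmul_eq_mul, Set.ncard_eq_toFinset_card']
    congr 3
    ext ℓ
    rw [Finset.mem_filter, Finset.mem_filter, Set.mem_toFinset, Set.mem_toFinset]
    exact ⟨fun hℓ => hℓ.2, fun hℓ => ⟨⟨hℓ.1, hℓ.2.1⟩, hℓ⟩⟩
  rw [hsum, hcount, gauss_two, Nat.add_one_sub_one, gauss_one, mul_one] at hle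
  have := le_of_mul_le_mul_right hle hα
  have h2 : ((b + 1 : ℕ) : ℝ) ≤ ((lineXY G L x y).ncard : ℝ) := by
    push_cast
    linarith
  exact_mod_cast h2

end HasClassicalParams

end Classical

/-- The SPLS property bounds the number of lines by `n / (c - 1)`. -/
lemma HasSPLS.ncard_lines_mul_lt [Fintype V] [Nonempty V] {G : SimpleGraph V} {a c s : ℕ}
    (h : HasSPLS G a c s) :
    ((splsLines G a c s).ncard : ℝ) * ((c : ℝ) - 1) < Fintype.card V := by
  classical
  obtain ⟨_, hs, ha, _, hτ, _⟩ := h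
  have hs0 : (0 : ℝ) < s := by exact_mod_cast (by omega : 0 < s)
  have hn : (0 : ℝ) < Fintype.card V := by exact_mod_cast Fintype.card_pos
  have hsize : ∀ ℓ ∈ (splsLines G a c s).toFinset, (s : ℝ) * (c - 1) + 2 ≤ ℓ.ncard := by
    intro ℓ hℓ
    have h1 := (Set.mem_toFinset.mp hℓ).2
    have h2 : (s : ℤ) * (c - 1) + 2 ≤ (ℓ.ncard : ℤ) := by nlinarith
    exact_mod_cast h2
  have hcount := Finset.sum_le_sum hsize
  rw [sum_ncard_lines, Finset.sum_const, nsmul_eq_mul, ← Set.ncard_eq_toFinset_card'] at hcount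
  have hτ' : ∑ x, ({ℓ ∈ splsLines G a c s | x ∈ ℓ}.ncard : ℝ) ≤ Fintype.card V * s := by
    calc _ ≤ ∑ _x : V, (s : ℝ) := Finset.sum_le_sum fun x _ => by exact_mod_cast hτ x
      _ = _ := by simp
  rcases (Nat.cast_nonneg (α := ℝ) (splsLines G a c s).ncard).eq_or_lt with h0 | h0
  · rw [← h0, zero_mul]
    exact hn
  · exact lt_of_mul_lt_mul_right (by nlinarith) hs0.le

end Aux

/-- if `Γ` has classical parameters `(D, b, α, β)`, `b ≥ 2`, `D ≥ 3`, and the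
SPLS(s) property, then more than `((c₂ - 2)/(c₂ - 1))·|V(Γ)|` vertices are Delsarte vertices,
and there are vertices `x, y` at distance 2 with `|[x, y]| ≥ b + 1`. -/
theorem statement_7 {V : Type*} [Fintype V] (G : SimpleGraph V) (D b : ℕ) (α β : ℝ)
    (cc aa bb : ℕ → ℕ) (hb : 2 ≤ b) (hD : 3 ≤ D)
    (h : HasClassicalParams G D b α β cc aa bb)
    (s : ℕ) (hs : 1 ≤ s) (hspls : HasSPLS G (aa 1) (cc 2) s) :
    (((cc 2 : ℝ) - 2) / ((cc 2 : ℝ) - 1) * (Fintype.card V : ℝ)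
      < ({x : V | IsDelsarteVertex (splsLines G (aa 1) (cc 2) s) β x}.ncard : ℝ)) ∧
    (∃ x y : V, G.dist x y = 2 ∧
      b + 1 ≤ (lineXY G (splsLines G (aa 1) (cc 2) s) x y).ncard) := by
  have hDRG := h.1
  have hcl : ∀ ℓ ∈ splsLines G (aa 1) (cc 2) s, G.IsClique ℓ := fun ℓ hℓ => hℓ.1.1
  have hpg := hspls.2.2.2.1
  have hc2 := h.two_lt_cc_two hb hD
  obtain ⟨x₀, _⟩ := hDRG.exists_dist_eq (Nat.zero_le D)
  have : Nonempty V := ⟨x₀⟩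
  set L := splsLines G (aa 1) (cc 2) s with hL
  set Δ : Set V := {x : V | IsDelsarteVertex L β x} with hΔ
  have hcompl : Δᶜ.ncard ≤ L.ncard :=
    ncard_le_ncard_lines hcl hpg
      (quadratic_form_nonneg_of_eigenvalues fun θ f hf0 hf => h.neg_gauss_le_eigenvalue hb hf0 hf)
      _ (fun x => (h.gauss_le_ncard_lines hb (by omega) hcl hpg x).1)
      (fun x hx => (h.gauss_le_ncard_lines hb (by omega) hcl hpg x).2 hx)
  have hadd : (Δ.ncard : ℝ) + Δᶜ.ncard = Fintype.card V := by
    rw [← Nat.card_eq_fintype_card]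
    exact_mod_cast Set.ncard_add_ncard_compl Δ
  have hlt := hspls.ncard_lines_mul_lt
  have hfirst : ((cc 2 : ℝ) - 2) / ((cc 2 : ℝ) - 1) * (Fintype.card V : ℝ) < Δ.ncard := by
    rw [div_mul_eq_mul_div, div_lt_iff₀ (by linarith)]
    have : (Δᶜ.ncard : ℝ) * ((cc 2 : ℝ) - 1) ≤ L.ncard * ((cc 2 : ℝ) - 1) :=
      mul_le_mul_of_nonneg_right (by exact_mod_cast hcompl) (by linarith)
    rw [← hadd] at hlt ⊢
    linarith
  refine ⟨hfirst, ?_⟩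
  have hpos : (0 : ℝ) < Δ.ncard := lt_of_le_of_lt
    (mul_nonneg (div_nonneg (by linarith) (by linarith)) (Nat.cast_nonneg _)) hfirst
  obtain ⟨x, hx⟩ := (Set.ncard_pos (s := Δ)).mp (by exact_mod_cast hpos)
  obtain ⟨z, _, hz⟩ := hDRG.exists_adj_dist_eq_succ (i := 0) (by omega) (x := x) (y := x) (by simp)
  obtain ⟨y, _, hy⟩ := hDRG.exists_adj_dist_eq_succ (i := 1) (by omega) hz
  exact ⟨x, y, hy, h.le_ncard_lineXY hb (by omega) hcl hpg hx hy⟩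

end DRGPaper
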